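/- (Homogeneous Average Rate) Let S ~ Γ[k_s, θ_s] (signal power) and I ~ Γ[k_i, θ_i] (interference power) be independent, with k_s, θ_s, k_i, θ_i > 0. Define θ_min = min{θ_s, θ_i}, ρ = k_s + k_i, C = (θ_min/θ_s)^{k_s}(θ_min/θ_i)^{k_i}, γ_p = p^{-1}[k_s(1 − θ_min/θ_s)^p + k_i(1 − θ_min/θ_i)^p] for p ≥ 1, and c_0 = 1, c_{n+1} = (1/(n+1)) Σ_{p=1}^{n+1} p γ_p c_{n+1−p}. Then the average rate τ = E[ln(1 + S/I)] satisfies τ = ψ(ρ) + ln(θ_min) + C Σ_{n=0}^∞ c_n Σ_{m=0}^{n−1} 1/(ρ + m) − ψ(k_i) − ln(θ_i), where ψ is the digamma function (the inner sum is empty for n = 0). -/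

import Mathlib

open MeasureTheory ProbabilityTheory

/-- The digamma function `ψ(x) = Γ'(x)/Γ(x)`. -/
noncomputable def digamma (x : ℝ) : ℝ := deriv Real.Gamma x / Real.Gamma x

/-- The Moschopoulos coefficients: `c 0 = 1` and
`c (n+1) = (1/(n+1)) ∑_{p=1}^{n+1} p * γ p * c (n+1-p)`. -/
noncomputable def mosC (γ : ℕ → ℝ) : ℕ → ℝ
  | 0 => 1
  | (n + 1) => (1 / (n + 1 : ℝ)) *
      ∑ p ∈ Finset.range (n + 1), ((p : ℝ) + 1) * γ (p + 1) * mosC γ (n - p)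
  decreasing_by exact Nat.lt_succ_of_le (Nat.sub_le n p)


section Aux
open Set Filter Topology

lemma aux_mosC_step (γ : ℕ → ℝ) (b β : ℝ)
    (h : ∀ p : ℕ, 1 ≤ p → γ p = (p : ℝ)⁻¹ * (b * β ^ p)) (n : ℕ) :
    ((n : ℝ) + 1) * mosC γ (n + 1) = β * (b + n) * mosC γ n := by
  have key : ∀ n : ℕ, ((n : ℝ) + 1) * mosC γ (n + 1) =
      ∑ p ∈ Finset.range (n + 1), b * β ^ (p + 1) * mosC γ (n - p) := by
    intro n
    rw [mosC]
    have hn : (n : ℝ) + 1 ≠ 0 := by positivity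
    rw [← mul_assoc, mul_one_div_cancel hn, one_mul]
    refine Finset.sum_congr rfl fun p _ => ?_
    have hp : (p : ℝ) + 1 ≠ 0 := by positivity
    rw [h (p + 1) (by omega)]
    push_cast
    field_simp
  rw [key n]
  cases n with
  | zero => simp [mosC]; ring
  | succ m =>
    rw [Finset.sum_range_succ']
    have h2 : ∑ k ∈ Finset.range (m + 1), b * β ^ (k + 1 + 1) * mosC γ (m + 1 - (k + 1)) =
        β * ∑ p ∈ Finset.range (m + 1), b * β ^ (p + 1) * mosC γ (m - p) := by
      rw [Finset.mul_sum]
      refine Finset.sum_congr rfl fun p _ => ?_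
      rw [Nat.add_sub_add_right]; ring
    rw [h2, ← key m]
    push_cast
    simp
    ring

lemma aux_mosC (γ : ℕ → ℝ) (b β : ℝ) (hb : 0 < b)
    (h : ∀ p : ℕ, 1 ≤ p → γ p = (p : ℝ)⁻¹ * (b * β ^ p)) (n : ℕ) :
    mosC γ n = Real.Gamma (b + n) / (Real.Gamma b * n.factorial) * β ^ n := by
  have hG := (Real.Gamma_pos_of_pos hb).ne'
  induction n with
  | zero => simp [mosC, hG]
  | succ n ih =>
    have h1 := aux_mosC_step γ b β h n
    have hn : (n : ℝ) + 1 ≠ 0 := by positivity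
    have h2 : mosC γ (n + 1) = β * (b + n) * mosC γ n / (n + 1) := by
      rw [← h1]; field_simp
    have h3 : Real.Gamma (b + (n + 1 : ℕ)) = (b + n) * Real.Gamma (b + n) := by
      rw [← Real.Gamma_add_one (by positivity)]; push_cast; ring_nf
    rw [h2, ih, h3, Nat.factorial_succ]
    push_cast
    field_simp
    ring

lemma aux_digamma (x : ℝ) (hx : 0 < x) (n : ℕ) :
    digamma (x + n) = digamma x + ∑ m ∈ Finset.range n, 1 / (x + m) := by
  induction n with
  | zero => simp
  | succ n ih =>
    have hy : 0 < x + n := by positivity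
    rw [Finset.sum_range_succ, ← add_assoc, ← ih, Nat.cast_succ, ← add_assoc]
    generalize x + (n : ℝ) = y at hy
    have hd : DifferentiableAt ℝ Real.Gamma y :=
      Real.differentiableAt_Gamma fun m => by
        have : (0 : ℝ) ≤ m := m.cast_nonneg
        linarith
    have hder : deriv Real.Gamma (y + 1) = Real.Gamma y + y * deriv Real.Gamma y := by
      rw [← deriv_comp_add_const]
      have : (fun z => Real.Gamma (z + 1)) =ᶠ[𝓝 y] fun z => z * Real.Gamma z := by
        filter_upwards [isOpen_ne.mem_nhds hy.ne'] with z hz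
        exact Real.Gamma_add_one hz
      rw [this.deriv_eq, deriv_fun_mul differentiableAt_fun_id hd]
      simp
    have := (Real.Gamma_pos_of_pos hy).ne'
    rw [digamma, digamma, hder, Real.Gamma_add_one hy.ne']
    field_simp
    ring

lemma aux_density (a r : ℝ) : gammaMeasure a r = (volume.restrict (Ioi (0 : ℝ))).withDensity
    (fun x => ENNReal.ofReal (r ^ a / (Real.Gamma a) * x ^ (a - 1) * Real.exp (-(r * x)))) := by
  rw [gammaMeasure, ← withDensity_indicator measurableSet_Ioi]
  refine withDensity_congr_ae ?_
  filter_upwards [compl_mem_ae_iff.mpr (measure_singleton (0 : ℝ))] with x hx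
  rcases lt_or_gt_of_ne hx with h | h
  · rw [gammaPDF_of_neg h, indicator_of_notMem (by simpa using h.le)]
  · rw [gammaPDF_of_nonneg h.le, indicator_of_mem (by simpa using h)]

lemma aux_pos (a r : ℝ) : ∀ᵐ x ∂(gammaMeasure a r), 0 < x := by
  rw [aux_density]
  exact (withDensity_absolutelyContinuous _ _).ae_le (ae_restrict_mem measurableSet_Ioi)

lemma aux_integral {E : Type*} [NormedAddCommGroup E] [NormedSpace ℝ E]
    (a r : ℝ) (ha : 0 < a) (hr : 0 < r) (f : ℝ → E) :
    ∫ x, f x ∂(gammaMeasure a r) =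
      ∫ x in Ioi 0, (r ^ a / (Real.Gamma a) * x ^ (a - 1) * Real.exp (-(r * x))) • f x := by
  rw [aux_density, integral_withDensity_eq_integral_toReal_smul (by fun_prop) (by simp)]
  refine setIntegral_congr_fun measurableSet_Ioi fun x hx => ?_
  have hx : 0 < x := hx
  have := Real.Gamma_pos_of_pos ha
  rw [ENNReal.toReal_ofReal (by positivity)]

lemma aux_integrable 
    (a r : ℝ) (ha : 0 < a) (hr : 0 < r) (f : ℝ → ℝ)
    (h : IntegrableOn (fun x => (r ^ a / (Real.Gamma a) * x ^ (a - 1) * Real.exp (-(r * x))) * f x)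
      (Ioi 0)) : Integrable f (gammaMeasure a r) := by
  rw [aux_density, integrable_withDensity_iff_integrable_smul' (by fun_prop) (by simp)]
  refine (integrableOn_congr_fun (fun x hx => ?_) measurableSet_Ioi).mpr h
  have hx : 0 < x := hx
  have := Real.Gamma_pos_of_pos ha
  simp only [smul_eq_mul]
  rw [ENNReal.toReal_ofReal (by positivity)]

lemma aux_conv (a b r : ℝ) (ha : 0 < a) (hb : 0 < b) (hr : 0 < r) :
    (gammaMeasure a r).conv (gammaMeasure b r) = gammaMeasure (a + b) r := by
  have := isProbabilityMeasure_gammaMeasure ha hr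
  have := isProbabilityMeasure_gammaMeasure hb hr
  have := isProbabilityMeasure_gammaMeasure (add_pos ha hb) hr
  have hGa := Real.Gamma_pos_of_pos ha
  have hGb := Real.Gamma_pos_of_pos hb
  have hGab := Real.Gamma_pos_of_pos (add_pos ha hb)
  have hm : ∀ c, Measurable (gammaPDF c r) := fun c => (measurable_gammaPDFReal c r).ennreal_ofReal
  obtain ⟨K, hK⟩ : ∃ K : ENNReal,
      (gammaMeasure a r).conv (gammaMeasure b r) = K • gammaMeasure (a + b) r := by
    let h : ℝ → ENNReal := fun u => ENNReal.ofReal (if 0 ≤ u ∧ 0 ≤ 1 - u then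
      (r ^ a / Real.Gamma a) * (r ^ b / Real.Gamma b) * (u ^ (a - 1) * (1 - u) ^ (b - 1)) else 0)
    refine ⟨(∫⁻ u, h u) * ENNReal.ofReal (Real.Gamma (a + b) / r ^ (a + b)), ?_⟩
    unfold gammaMeasure
    rw [conv_withDensity_eq_lconvolution (hm a) (hm b), ← withDensity_smul _ (hm _)]
    refine withDensity_congr_ae ?_
    filter_upwards [compl_mem_ae_iff.mpr (measure_singleton (0 : ℝ))] with x hx
    rw [lconvolution_def]
    simp only [Pi.smul_apply, smul_eq_mul]
    rcases lt_or_gt_of_ne hx with hx | hx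
    · rw [gammaPDF_of_neg hx, mul_zero, ← lintegral_zero (μ := (volume : Measure ℝ))]
      refine lintegral_congr fun y => ?_
      rcases lt_or_ge y 0 with hy | hy
      · rw [gammaPDF_of_neg hy, zero_mul]
      · rw [gammaPDF_of_neg (x := -y + x) (by linarith), mul_zero]
    · have h1 : ∫⁻ u, gammaPDF a r (x * u) * gammaPDF b r (-(x * u) + x) =
          ENNReal.ofReal x⁻¹ * ∫⁻ y, gammaPDF a r y * gammaPDF b r (-y + x) := by
        have hF : Measurable fun y => gammaPDF a r y * gammaPDF b r (-y + x) :=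
          (hm a).mul ((hm b).comp (by fun_prop))
        rw [← lintegral_map (f := fun y => gammaPDF a r y * gammaPDF b r (-y + x))
          (g := fun u => x * u) hF (by fun_prop), Real.map_volume_mul_left hx.ne',
          lintegral_smul_measure, abs_of_pos (inv_pos.mpr hx), smul_eq_mul]
      have h2 : ∀ u, gammaPDF a r (x * u) * gammaPDF b r (-(x * u) + x) =
          ENNReal.ofReal (x ^ (a + b - 2) * Real.exp (-(r * x))) * h u := by
        intro u
        by_cases hu : 0 ≤ u ∧ 0 ≤ 1 - u
        · obtain ⟨hu0, hu1⟩ := hu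
          have e : -(x * u) + x = x * (1 - u) := by ring
          rw [e, gammaPDF_of_nonneg (by positivity), gammaPDF_of_nonneg (by positivity),
            ← ENNReal.ofReal_mul (by positivity)]
          simp only [h, hu0, hu1, and_self, if_true]
          rw [← ENNReal.ofReal_mul (by positivity)]
          congr 1
          rw [Real.mul_rpow hx.le hu0, Real.mul_rpow hx.le hu1,
            show a + b - 2 = (a - 1) + (b - 1) by ring, Real.rpow_add hx,
            show -(r * x) = -(r * (x * u)) + -(r * (x * (1 - u))) by ring, Real.exp_add]
          ring
        · have : h u = 0 := by simp only [h, hu, if_false, ENNReal.ofReal_zero]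
          rw [this, mul_zero]
          rcases lt_or_ge u 0 with hu0 | hu0
          · rw [gammaPDF_of_neg (mul_neg_of_pos_of_neg hx hu0), zero_mul]
          · have : 1 - u < 0 := by
              by_contra hc
              exact hu ⟨hu0, not_lt.mp hc⟩
            rw [gammaPDF_of_neg (x := -(x * u) + x) (by nlinarith), mul_zero]
      have h3 : ∫⁻ y, gammaPDF a r y * gammaPDF b r (-y + x) =
          ENNReal.ofReal x * ∫⁻ u, gammaPDF a r (x * u) * gammaPDF b r (-(x * u) + x) := by
        rw [h1, ← mul_assoc, ← ENNReal.ofReal_mul hx.le, mul_inv_cancel₀ hx.ne']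
        simp
      have hmh : Measurable h := by
        refine Measurable.ennreal_ofReal (Measurable.ite ?_ (by fun_prop) measurable_const)
        exact (measurableSet_le measurable_const measurable_id).inter
          (measurableSet_le measurable_const (measurable_const.sub measurable_id))
      rw [h3]
      simp_rw [h2]
      rw [lintegral_const_mul _ hmh, gammaPDF_of_nonneg hx.le, ← mul_assoc,
        mul_assoc (∫⁻ u, h u), mul_comm (∫⁻ u, h u), ← ENNReal.ofReal_mul hx.le,
        ← ENNReal.ofReal_mul (by positivity)]
      congr 2
      have := (Real.rpow_pos_of_pos hr (a + b)).ne'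
      rw [show a + b - 1 = (a + b - 2) + 1 by ring, Real.rpow_add hx, Real.rpow_one]
      field_simp
  have h1 := congrArg (fun ν => ν univ) hK
  simp only [Measure.smul_apply, measure_univ, smul_eq_mul, mul_one] at h1
  rw [hK, ← h1, one_smul]

lemma aux_mix (b r r' : ℝ) (hb : 0 < b) (hr' : 0 < r') (hrr : r' ≤ r) :
    gammaMeasure b r' = Measure.sum fun n : ℕ => ENNReal.ofReal ((r' / r) ^ b *
      (Real.Gamma (b + n) / (Real.Gamma b * n.factorial) * (1 - r' / r) ^ n)) •
      gammaMeasure (b + n) r := by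
  have hr : 0 < r := hr'.trans_le hrr
  have hβ : 0 ≤ 1 - r' / r := by rw [sub_nonneg, div_le_one hr]; exact hrr
  simp_rw [aux_density]
  simp_rw [← withDensity_smul' _ _ ENNReal.ofReal_ne_top]
  rw [← withDensity_tsum (fun n => by fun_prop)]
  refine withDensity_congr_ae ?_
  filter_upwards [ae_restrict_mem measurableSet_Ioi] with x hx
  have hx : 0 < x := hx
  have hGb := Real.Gamma_pos_of_pos hb
  have hG : ∀ n : ℕ, 0 < Real.Gamma (b + n) := fun n => Real.Gamma_pos_of_pos (by positivity)
  rw [tsum_apply (Pi.summable.mpr fun _ => ENNReal.summable)]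
  simp only [Pi.smul_apply, smul_eq_mul]
  have hs : HasSum (fun n : ℕ => ((r' / r) ^ b *
      (Real.Gamma (b + n) / (Real.Gamma b * n.factorial) * (1 - r' / r) ^ n)) *
      (r ^ (b + n) / Real.Gamma (b + n) * x ^ (b + n - 1) * Real.exp (-(r * x))))
      (r' ^ b / Real.Gamma b * x ^ (b - 1) * Real.exp (-(r' * x))) := by
    have h1 := (NormedSpace.expSeries_div_hasSum_exp ((1 - r' / r) * r * x)).mul_left
      (r' ^ b / Real.Gamma b * x ^ (b - 1) * Real.exp (-(r * x)))
    rw [← Real.exp_eq_exp_ℝ] at h1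
    have e1 : ∀ A B : ℕ → ℝ, ∀ u v : ℝ, HasSum A u → (∀ n, B n = A n) → v = u → HasSum B v := by
      intro A B u v h h' h''
      rw [h'', funext h']; exact h
    refine e1 _ _ _ _ h1 ?_ ?_
    · intro n
      have := (hG n).ne'
      rw [show b + (n : ℝ) - 1 = (b - 1) + n by ring, Real.rpow_add hx, Real.rpow_add hr,
        Real.rpow_natCast, Real.rpow_natCast, Real.div_rpow hr'.le hr.le, mul_pow, mul_pow]
      have := (Real.rpow_pos_of_pos hr b).ne'
      field_simp
    · rw [mul_assoc _ (Real.exp _), ← Real.exp_add]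
      congr 2
      field_simp
      ring
  rw [← hs.tsum_eq, ENNReal.ofReal_tsum_of_nonneg _ hs.summable]
  · refine tsum_congr fun n => ?_
    have := hG n
    rw [ENNReal.ofReal_mul (by positivity)]
  · intro n
    have := hG n
    positivity

lemma aux_gammaDeriv (a : ℝ) (ha : 0 < a) :
    IntegrableOn (fun t : ℝ => t ^ (a - 1) * (Real.log t * Real.exp (-t))) (Ioi 0) ∧
    deriv Real.Gamma a = ∫ t in Ioi (0 : ℝ), t ^ (a - 1) * (Real.log t * Real.exp (-t)) := by
  have hs : 0 < (a : ℂ).re := by simpa using ha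
  have hcast : ∀ t ∈ Ioi (0 : ℝ), (t : ℂ) ^ ((a : ℂ) - 1) * (Real.log t * Real.exp (-t)) =
      ((t ^ (a - 1) * (Real.log t * Real.exp (-t)) : ℝ) : ℂ) := by
    intro t ht
    have ht : 0 < t := ht
    push_cast
    rw [Complex.ofReal_cpow ht.le, Complex.ofReal_log ht.le]
    push_cast
    rfl
  have hM : MellinConvergent (fun t => Real.log t • ((Real.exp (-t) : ℝ) : ℂ)) (a : ℂ) := by
    refine (mellin_hasDerivAt_of_isBigO_rpow (E := ℂ) ?_ ?_ (lt_add_one _) ?_ hs).1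
    · refine (Continuous.continuousOn ?_).locallyIntegrableOn measurableSet_Ioi
      exact Complex.continuous_ofReal.comp (Real.continuous_exp.comp continuous_neg)
    · rw [← Asymptotics.isBigO_norm_left]
      simp_rw [Complex.norm_real, Asymptotics.isBigO_norm_left]
      simpa only [neg_one_mul] using (isLittleO_exp_neg_mul_rpow_atTop zero_lt_one _).isBigO
    · simp_rw [neg_zero, Real.rpow_zero]
      refine Asymptotics.isBigO_const_of_tendsto (?_ : Tendsto _ _ (𝓝 (1 : ℂ))) one_ne_zero
      rw [(by simp : (1 : ℂ) = Real.exp (-0))]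
      exact (Complex.continuous_ofReal.comp
        (Real.continuous_exp.comp continuous_neg)).continuousWithinAt
  constructor
  · have h1 : IntegrableOn (fun t : ℝ =>
        ((t ^ (a - 1) * (Real.log t * Real.exp (-t)) : ℝ) : ℂ)) (Ioi 0) := by
      refine (integrableOn_congr_fun (fun t ht => ?_) measurableSet_Ioi).mp hM
      rw [← hcast t ht]
      simp
    exact h1.re
  · have h1 := (Complex.hasDerivAt_GammaIntegral hs).real_of_complex
    have h2 : Real.Gamma =ᶠ[𝓝 a] fun x : ℝ => (Complex.GammaIntegral x).re := by
      filter_upwards [isOpen_Ioi.mem_nhds (show a ∈ Ioi (0 : ℝ) from ha)] with x hx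
      rw [Real.Gamma, Complex.Gamma_eq_integral (by simpa using hx)]
    rw [h2.deriv_eq, h1.deriv, setIntegral_congr_fun measurableSet_Ioi hcast]
    rw [integral_complex_ofReal, Complex.ofReal_re]

lemma aux_log (a r : ℝ) (ha : 0 < a) (hr : 0 < r) :
    Integrable Real.log (gammaMeasure a r) ∧
    ∫ x, Real.log x ∂(gammaMeasure a r) = digamma a - Real.log r := by
  obtain ⟨h1, h2⟩ := aux_gammaDeriv a ha
  have hG := Real.Gamma_pos_of_pos ha
  have h3 := Real.GammaIntegral_convergent ha
  let g : ℝ → ℝ := fun u => (Real.Gamma a)⁻¹ * (u ^ (a - 1) * (Real.log u * Real.exp (-u))) -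
    (Real.Gamma a)⁻¹ * Real.log r * (Real.exp (-u) * u ^ (a - 1))
  have hg : IntegrableOn g (Ioi 0) := (h1.const_mul _).sub (h3.const_mul _)
  have hgi : ∫ u in Ioi 0, g u = digamma a - Real.log r := by
    simp only [g]
    rw [integral_sub (h1.const_mul _) (h3.const_mul _), integral_const_mul, integral_const_mul,
      ← h2, ← Real.Gamma_eq_integral ha, digamma]
    field_simp
  have hEq : ∀ x ∈ Ioi (0 : ℝ), (r ^ a / (Real.Gamma a) * x ^ (a - 1) * Real.exp (-(r * x))) *
      Real.log x = r * g (r * x) := by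
    intro x hx
    have hx : 0 < x := hx
    simp only [g]
    rw [Real.log_mul hr.ne' hx.ne', Real.mul_rpow hr.le hx.le,
      show r ^ a = r ^ (a - 1) * r by rw [← Real.rpow_add_one hr.ne']; ring_nf]
    field_simp
    ring
  constructor
  · refine aux_integrable a r ha hr _ ?_
    refine (integrableOn_congr_fun hEq measurableSet_Ioi).mpr ?_
    refine Integrable.const_mul ?_ r
    have := (integrableOn_Ioi_comp_mul_left_iff g 0 hr).mpr (by simpa using hg)
    exact this
  · rw [aux_integral a r ha hr]
    simp only [smul_eq_mul]
    rw [setIntegral_congr_fun measurableSet_Ioi hEq, integral_const_mul,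
      integral_comp_mul_left_Ioi g 0 hr, mul_zero, hgi, smul_eq_mul, ← mul_assoc,
      mul_inv_cancel₀ hr.ne', one_mul]

lemma aux_main (a b r r' : ℝ) (ha : 0 < a) (hb : 0 < b) (hr' : 0 < r') (hrr : r' ≤ r)
    (hint : Integrable Real.log ((gammaMeasure a r).conv (gammaMeasure b r'))) :
    ∫ x, Real.log x ∂((gammaMeasure a r).conv (gammaMeasure b r')) =
      digamma (a + b) - Real.log r + (r' / r) ^ b *
      ∑' n : ℕ, (Real.Gamma (b + n) / (Real.Gamma b * n.factorial) * (1 - r' / r) ^ n) *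
        ∑ m ∈ Finset.range n, 1 / (a + b + m) := by
  have hr : 0 < r := hr'.trans_le hrr
  have hβ : 0 ≤ 1 - r' / r := by rw [sub_nonneg, div_le_one hr]; exact hrr
  have := isProbabilityMeasure_gammaMeasure ha hr
  have := isProbabilityMeasure_gammaMeasure hb hr'
  have hbn : ∀ n : ℕ, 0 < b + n := fun n => by positivity
  have hPn : ∀ n : ℕ, IsProbabilityMeasure (gammaMeasure (b + n) r) :=
    fun n => isProbabilityMeasure_gammaMeasure (hbn n) hr
  have hPn' : ∀ n : ℕ, IsProbabilityMeasure (gammaMeasure (a + (b + n)) r) :=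
    fun n => isProbabilityMeasure_gammaMeasure (add_pos ha (hbn n)) hr
  let w : ℕ → ℝ := fun n => (r' / r) ^ b *
      (Real.Gamma (b + n) / (Real.Gamma b * n.factorial) * (1 - r' / r) ^ n)
  have hw : ∀ n, 0 ≤ w n := fun n => by
    have := Real.Gamma_pos_of_pos hb
    have := Real.Gamma_pos_of_pos (hbn n)
    positivity
  have hconv : (gammaMeasure a r).conv (gammaMeasure b r') =
      Measure.sum fun n : ℕ => ENNReal.ofReal (w n) • gammaMeasure (a + (b + n)) r := by
    rw [aux_mix b r r' hb hr' hrr, Measure.conv, Measure.prod_sum_right,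
      Measure.map_sum (by fun_prop)]
    congr 1
    funext n
    rw [Measure.prod_smul_right, Measure.map_smul, ← aux_conv a (b + n) r ha (hbn n) hr]
    rfl
  have hs1 := hasSum_integral_measure (hconv ▸ hint)
  have hint1 : Integrable (fun _ : ℝ => (1 : ℝ))
      ((gammaMeasure a r).conv (gammaMeasure b r')) := integrable_const (1 : ℝ)
  have hs2 := hasSum_integral_measure (hconv ▸ hint1)
  rw [← hconv] at hs1 hs2
  simp only [integral_smul_measure, ENNReal.toReal_ofReal (hw _), smul_eq_mul, integral_const,
    probReal_univ, mul_one, measureReal_ennreal_smul_apply] at hs1 hs2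
  have hs3 := hs1.sub (hs2.mul_right (digamma (a + b) - Real.log r))
  have e : ∀ n, w n * ∫ x, Real.log x ∂(gammaMeasure (a + (b + n)) r) -
      w n * (digamma (a + b) - Real.log r) = (r' / r) ^ b *
      ((Real.Gamma (b + n) / (Real.Gamma b * n.factorial) * (1 - r' / r) ^ n) *
        ∑ m ∈ Finset.range n, 1 / (a + b + m)) := by
    intro n
    rw [(aux_log _ r (add_pos ha (hbn n)) hr).2, ← add_assoc, aux_digamma _ (add_pos ha hb)]
    simp only [w]
    ring
  rw [← tsum_mul_left, ← tsum_congr e, hs3.tsum_eq]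
  ring

end Aux

/-- **Homogeneous Average Rate.** With independent `S ~ Γ[k_s, θ_s]` (signal) and
`I ~ Γ[k_i, θ_i]` (interference), `θmin = min{θ_s, θ_i}`, `ρ = k_s + k_i`,
`C = (θmin/θ_s)^{k_s}(θmin/θ_i)^{k_i}`,
`γ_p = p⁻¹[k_s(1−θmin/θ_s)^p + k_i(1−θmin/θ_i)^p]` and `c_n` the Moschopoulos
coefficients, the average rate satisfies
`E[ln(1+S/I)] = ψ(ρ) + ln(θmin) + C ∑_n c_n ∑_{m=0}^{n−1} 1/(ρ+m) − ψ(k_i) − ln(θ_i)`. -/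
theorem homogeneous_average_rate {Ω : Type*} [MeasurableSpace Ω] (μ : Measure Ω)
    [IsProbabilityMeasure μ] (ks θs ki θi : ℝ) (hks : 0 < ks) (hθs : 0 < θs)
    (hki : 0 < ki) (hθi : 0 < θi) (S I : Ω → ℝ)
    (hS : Measurable S) (hI : Measurable I)
    (hlawS : Measure.map S μ = gammaMeasure ks θs⁻¹)
    (hlawI : Measure.map I μ = gammaMeasure ki θi⁻¹)
    (hindep : IndepFun S I μ)
    (θmin ρ C : ℝ) (γ : ℕ → ℝ)
    (hθmin : θmin = min θs θi) (hρ : ρ = ks + ki)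
    (hC : C = (θmin / θs) ^ ks * (θmin / θi) ^ ki)
    (hγ : ∀ p : ℕ, 1 ≤ p →
      γ p = (p : ℝ)⁻¹ * (ks * (1 - θmin / θs) ^ p + ki * (1 - θmin / θi) ^ p)) :
    (∫ ω, Real.log (1 + S ω / I ω) ∂μ) =
      digamma ρ + Real.log θmin +
        C * (∑' n : ℕ, mosC γ n * ∑ m ∈ Finset.range n, 1 / (ρ + m)) -
        digamma ki - Real.log θi := by
  have hrs : 0 < θs⁻¹ := inv_pos.mpr hθs
  have hri : 0 < θi⁻¹ := inv_pos.mpr hθi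
  have hSpos : ∀ᵐ ω ∂μ, 0 < S ω := by
    have h := aux_pos ks θs⁻¹
    rw [← hlawS] at h
    exact ae_of_ae_map hS.aemeasurable h
  have hIpos : ∀ᵐ ω ∂μ, 0 < I ω := by
    have h := aux_pos ki θi⁻¹
    rw [← hlawI] at h
    exact ae_of_ae_map hI.aemeasurable h
  have hlogS : Integrable (fun ω => Real.log (S ω)) μ := by
    have h := (aux_log ks θs⁻¹ hks hrs).1
    rw [← hlawS] at h
    exact h.comp_measurable hS
  have hlogI : Integrable (fun ω => Real.log (I ω)) μ := by
    have h := (aux_log ki θi⁻¹ hki hri).1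
    rw [← hlawI] at h
    exact h.comp_measurable hI
  have hEI : ∫ ω, Real.log (I ω) ∂μ = digamma ki + Real.log θi := by
    have h := (aux_log ki θi⁻¹ hki hri).2
    rw [← hlawI, integral_map hI.aemeasurable Real.measurable_log.aestronglyMeasurable,
      Real.log_inv, sub_neg_eq_add] at h
    exact h
  have hlogSI : Integrable (fun ω => Real.log (S ω + I ω)) μ := by
    refine Integrable.mono' ((integrable_const (Real.log 2)).add (hlogS.norm.add hlogI.norm))
      (Real.measurable_log.comp (hS.add hI)).aestronglyMeasurable ?_
    filter_upwards [hSpos, hIpos] with ω h1 h2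
    simp only [Pi.add_apply, Real.norm_eq_abs]
    have hl2 : 0 ≤ Real.log 2 := Real.log_nonneg (by norm_num)
    have hlow : Real.log (S ω) ≤ Real.log (S ω + I ω) := Real.log_le_log h1 (by linarith)
    have a1 := abs_le.mp (le_refl |Real.log (S ω)|)
    have a2 := abs_le.mp (le_refl |Real.log (I ω)|)
    have p1 := abs_nonneg (Real.log (S ω))
    have p2 := abs_nonneg (Real.log (I ω))
    rw [abs_le]
    refine ⟨by linarith, ?_⟩
    rcases le_total (S ω) (I ω) with h | h
    · have : Real.log (S ω + I ω) ≤ Real.log (2 * I ω) :=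
        Real.log_le_log (by linarith) (by linarith)
      rw [Real.log_mul two_ne_zero h2.ne'] at this
      linarith
    · have : Real.log (S ω + I ω) ≤ Real.log (2 * S ω) :=
        Real.log_le_log (by linarith) (by linarith)
      rw [Real.log_mul two_ne_zero h1.ne'] at this
      linarith
  have hsplit : ∫ ω, Real.log (1 + S ω / I ω) ∂μ =
      ∫ ω, Real.log (S ω + I ω) ∂μ - ∫ ω, Real.log (I ω) ∂μ := by
    rw [← integral_sub hlogSI hlogI]
    refine integral_congr_ae ?_
    filter_upwards [hSpos, hIpos] with ω h1 h2
    rw [← Real.log_div (by positivity) h2.ne']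
    congr 1
    field_simp
    ring
  have hmapSI : Measure.map (S + I) μ = (gammaMeasure ks θs⁻¹).conv (gammaMeasure ki θi⁻¹) := by
    rw [hindep.map_add_eq_map_conv_map hS hI, hlawS, hlawI]
  have hmapIS : Measure.map (S + I) μ = (gammaMeasure ki θi⁻¹).conv (gammaMeasure ks θs⁻¹) := by
    rw [add_comm, hindep.symm.map_add_eq_map_conv_map hI hS, hlawS, hlawI]
  have hintm : Integrable Real.log (Measure.map (S + I) μ) :=
    (integrable_map_measure Real.measurable_log.aestronglyMeasurable
      (hS.add hI).aemeasurable).mpr hlogSI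
  have hEm : ∫ ω, Real.log (S ω + I ω) ∂μ = ∫ x, Real.log x ∂(Measure.map (S + I) μ) := by
    rw [integral_map (hS.add hI).aemeasurable Real.measurable_log.aestronglyMeasurable]
    rfl
  have hfin : ∫ ω, Real.log (S ω + I ω) ∂μ = digamma ρ + Real.log θmin +
      C * (∑' n : ℕ, mosC γ n * ∑ m ∈ Finset.range n, 1 / (ρ + m)) := by
    rcases le_total θs θi with h | h
    · have hm : θmin = θs := by rw [hθmin, min_eq_left h]
      subst hm
      have hmos := aux_mosC γ ki (1 - θmin / θi) hki fun p hp => by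
        rw [hγ p hp, div_self hθs.ne', sub_self, zero_pow (by omega)]
        ring
      have hr : θi⁻¹ / θmin⁻¹ = θmin / θi := by field_simp
      rw [hEm, hmapSI, aux_main ks ki _ _ hks hki hri ((inv_le_inv₀ hθi hθs).mpr h)
        (hmapSI ▸ hintm), hC, hρ, hr, div_self hθs.ne', Real.one_rpow, one_mul, Real.log_inv,
        sub_neg_eq_add]
      simp only [hmos]
    · have hm : θmin = θi := by rw [hθmin, min_eq_right h]
      subst hm
      have hmos := aux_mosC γ ks (1 - θmin / θs) hks fun p hp => by
        rw [hγ p hp, div_self hθi.ne', sub_self, zero_pow (by omega)]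
        ring
      have hr : θs⁻¹ / θmin⁻¹ = θmin / θs := by field_simp
      rw [hEm, hmapIS, aux_main ki ks _ _ hki hks hrs ((inv_le_inv₀ hθs hθi).mpr h)
        (hmapIS ▸ hintm), hC, hρ, hr, div_self hθi.ne', Real.one_rpow, mul_one, Real.log_inv,
        sub_neg_eq_add, add_comm ki ks]
      simp only [hmos]
  rw [hsplit, hEI, hfin]
  ring
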